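/- Let n ∈ ℕ, r₁,…,rₙ > 0, let K be a singular, strictly concave and strictly monotone (SM) kernel function, and let J be an upper semicontinuous n-field function. Then for node systems x, y ∈ Y majorization cannot hold: if mⱼ(x) ≤ mⱼ(y) for every j ∈ {0,1,…,n}, then x = y. Equivalently, for any two distinct x, y ∈ Y there are indices i, j with m_i(x) < m_i(y) and m_j(x) > m_j(y). -/

import Mathlib

open Set Filter

noncomputable section

/-- A kernel function: `ℝ ∪ {−∞}`-valued (modeled as `EReal`, never `⊤`),
finite and concave on `(-1,0)` and `(0,1)`, extended continuously to `[-1,1]`. -/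
structure IsKernel (K : ℝ → EReal) : Prop where
  ne_top : ∀ t, K t ≠ ⊤
  finite_off_zero : ∀ t ∈ Ioo (-1:ℝ) 1, t ≠ 0 → K t ≠ ⊥
  concave_neg : ConcaveOn ℝ (Ioo (-1:ℝ) 0) (fun t => (K t).toReal)
  concave_pos : ConcaveOn ℝ (Ioo (0:ℝ) 1) (fun t => (K t).toReal)
  lim_zero_left : Tendsto K (nhdsWithin 0 (Iio 0)) (nhds (K 0))
  lim_zero_right : Tendsto K (nhdsWithin 0 (Ioi 0)) (nhds (K 0))
  lim_neg_one : Tendsto K (nhdsWithin (-1) (Ioi (-1))) (nhds (K (-1)))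
  lim_one : Tendsto K (nhdsWithin 1 (Iio 1)) (nhds (K 1))

/-- Singularity condition `(∞)`: `K(0) = −∞`. -/
def SingularKernel (K : ℝ → EReal) : Prop := K 0 = ⊥

/-- Monotonicity condition (M). -/
def MonotoneKernel (K : ℝ → EReal) : Prop :=
  AntitoneOn K (Ioo (-1:ℝ) 0) ∧ MonotoneOn K (Ioo (0:ℝ) 1)

/-- Strict monotonicity condition (SM). -/
def StrictMonotoneKernel (K : ℝ → EReal) : Prop :=
  StrictAntiOn K (Ico (-1:ℝ) 0) ∧ StrictMonoOn K (Ioc (0:ℝ) 1)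

/-- Strict concavity of a kernel function. -/
def StrictConcaveKernel (K : ℝ → EReal) : Prop :=
  StrictConcaveOn ℝ (Ioo (-1:ℝ) 0) (fun t => (K t).toReal) ∧
  StrictConcaveOn ℝ (Ioo (0:ℝ) 1) (fun t => (K t).toReal)

/-- An `n`-field function: bounded above, never `+∞`, finite on a set of weighted
cardinality exceeding `n` (interior points of `[0,1]` count `1`, the endpoints `1/2`). -/
def IsFieldFn (n : ℕ) (J : ℝ → EReal) : Prop :=
  (∀ t, J t ≠ ⊤) ∧ (∃ M : ℝ, ∀ t ∈ Icc (0:ℝ) 1, J t ≤ (M : EReal)) ∧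
  ∃ T : Finset ℝ, (T : Set ℝ) ⊆ Icc (0:ℝ) 1 ∧ (∀ t ∈ T, J t ≠ ⊥) ∧
    (n : ℝ) < ∑ t ∈ T, (if t = 0 ∨ t = 1 then (1/2 : ℝ) else 1)

/-- The closed simplex `S̄`. -/
def closedSimplex (n : ℕ) : Set (Fin n → ℝ) :=
  {y | Monotone y ∧ ∀ j, y j ∈ Icc (0:ℝ) 1}

/-- The open simplex `S`. -/
def openSimplex (n : ℕ) : Set (Fin n → ℝ) :=
  {y | StrictMono y ∧ ∀ j, y j ∈ Ioo (0:ℝ) 1}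

/-- Extended nodes: `y₀ = 0`, `y_{n+1} = 1`. -/
def extNode {n : ℕ} (y : Fin n → ℝ) (j : Fin (n + 2)) : ℝ :=
  if _h0 : (j : ℕ) = 0 then 0
  else if _hn : (j : ℕ) ≤ n then y ⟨(j : ℕ) - 1, by omega⟩
  else 1

/-- The interval `I_j(y) = [y_j, y_{j+1}]`, `j = 0, …, n`. -/
def nodeInterval {n : ℕ} (y : Fin n → ℝ) (j : Fin (n + 1)) : Set ℝ :=
  Icc (extNode y j.castSucc) (extNode y j.succ)

/-- The sum of translates function `F(y,t) = J(t) + ∑ⱼ rⱼ K(t - yⱼ)`. -/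
def sumTrans {n : ℕ} (r : Fin n → ℝ) (K J : ℝ → EReal) (y : Fin n → ℝ) (t : ℝ) : EReal :=
  J t + ∑ j, (r j : EReal) * K (t - y j)

/-- The interval maximum `m_j(y) = sup_{t ∈ I_j(y)} F(y,t)`. -/
def mj {n : ℕ} (r : Fin n → ℝ) (K J : ℝ → EReal) (j : Fin (n + 1)) (y : Fin n → ℝ) : EReal :=
  sSup (sumTrans r K J y '' nodeInterval y j)

/-- `m̄(y) = max_j m_j(y)`. -/
def mbar {n : ℕ} (r : Fin n → ℝ) (K J : ℝ → EReal) (y : Fin n → ℝ) : EReal :=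
  ⨆ j, mj r K J j y

/-- `m̲(y) = min_j m_j(y)`. -/
def munder {n : ℕ} (r : Fin n → ℝ) (K J : ℝ → EReal) (y : Fin n → ℝ) : EReal :=
  ⨅ j, mj r K J j y

/-- The regularity set `Y`. -/
def regSet {n : ℕ} (r : Fin n → ℝ) (K J : ℝ → EReal) : Set (Fin n → ℝ) :=
  {y ∈ openSimplex n | ∀ j, mj r K J j y ≠ ⊥}

/-- Equioscillation: all interval maxima agree. -/
def Equioscillation {n : ℕ} (r : Fin n → ℝ) (K J : ℝ → EReal) (y : Fin n → ℝ) : Prop :=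
  ∀ i j : Fin (n + 1), mj r K J i y = mj r K J j y

/-- Strict form of Abel's inequality: nonnegative partial sums against weights that are strictly
decreasing on the support. -/
theorem sum_mul_lt_sum_mul_of_partial_sums_nonneg {c u : ℕ → ℝ} {N : ℕ}
    (hc : ∀ i j, i < j → j < N → u i ≠ 0 → u j ≠ 0 → c j < c i)
    (hS : ∀ m ≤ N, 0 ≤ ∑ k ∈ Finset.range m, u k) :
    ∀ m ≤ N, ∀ a : ℝ, (∀ k < m, u k ≠ 0 → a < c k) → (∃ k < m, u k ≠ 0) →
      (∑ k ∈ Finset.range m, u k) * a < ∑ k ∈ Finset.range m, c k * u k := by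
  intro m
  induction m with
  | zero => rintro - a - ⟨k, hk, -⟩; omega
  | succ m ih =>
    intro hm a ha hne
    have hS' := hS (m + 1) hm
    rw [Finset.sum_range_succ] at hS'
    rw [Finset.sum_range_succ, Finset.sum_range_succ]
    by_cases hu : u m = 0
    · obtain ⟨k, hk, huk⟩ := hne
      have hkm : k < m := lt_of_le_of_ne (by omega) (by rintro rfl; exact huk hu)
      have := ih (by omega) a (fun k hk => ha k (by omega)) ⟨k, hkm, huk⟩
      simpa [hu] using this
    · have ham := ha m (by omega) hu
      by_cases hlow : ∃ k < m, u k ≠ 0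
      · have := ih (by omega) (c m) (fun k hk huk => hc k m hk (by omega) huk hu) hlow
        nlinarith [mul_nonneg hS' (sub_nonneg.2 ham.le)]
      · push Not at hlow
        have h0 : ∑ k ∈ Finset.range m, u k = 0 :=
          Finset.sum_eq_zero fun k hk => hlow k (Finset.mem_range.1 hk)
        have h1 : ∑ k ∈ Finset.range m, c k * u k = 0 :=
          Finset.sum_eq_zero fun k hk => by rw [hlow k (Finset.mem_range.1 hk), mul_zero]
        rw [h0, zero_add] at hS' ⊢
        rw [h1, zero_add]
        nlinarith [mul_pos (lt_of_le_of_ne hS' (Ne.symm hu)) (sub_pos.2 ham)]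

theorem sum_mul_pos_of_partial_sums_nonneg {c u : ℕ → ℝ} {N : ℕ}
    (hc : ∀ i j, i < j → j < N → u i ≠ 0 → u j ≠ 0 → c j < c i)
    (hpos : ∀ k < N, u k ≠ 0 → 0 < c k)
    (hS : ∀ m ≤ N, 0 ≤ ∑ k ∈ Finset.range m, u k) (hne : ∃ k < N, u k ≠ 0) :
    0 < ∑ k ∈ Finset.range N, c k * u k := by
  simpa using sum_mul_lt_sum_mul_of_partial_sums_nonneg hc hS N le_rfl 0 hpos hne

theorem sum_mul_nonneg_of_partial_sums_nonneg {c u : ℕ → ℝ} {N : ℕ}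
    (hc : ∀ i j, i < j → j < N → u i ≠ 0 → u j ≠ 0 → c j < c i)
    (hpos : ∀ k < N, u k ≠ 0 → 0 < c k)
    (hS : ∀ m ≤ N, 0 ≤ ∑ k ∈ Finset.range m, u k) :
    0 ≤ ∑ k ∈ Finset.range N, c k * u k := by
  by_cases hne : ∃ k < N, u k ≠ 0
  · exact (sum_mul_pos_of_partial_sums_nonneg hc hpos hS hne).le
  · push Not at hne
    exact (Finset.sum_eq_zero fun k hk => by rw [hne k (Finset.mem_range.1 hk), mul_zero]).ge

/-- If the partial sums of `u` are minimal at `j`, and the weights `c` are negative before `j`,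
positive from `j` on, and strictly decreasing on either side, then `∑ c k * u k > 0`. -/
theorem sum_mul_pos_of_partial_sums_min {c u : ℕ → ℝ} {N j : ℕ} (hj : j ≤ N)
    (hmin : ∀ m ≤ N, ∑ k ∈ Finset.range j, u k ≤ ∑ k ∈ Finset.range m, u k)
    (hneg : ∀ k < j, u k ≠ 0 → c k < 0)
    (hpos : ∀ k, j ≤ k → k < N → u k ≠ 0 → 0 < c k)
    (hleft : ∀ i k, i < k → k < j → u i ≠ 0 → u k ≠ 0 → c k < c i)
    (hright : ∀ i k, j ≤ i → i < k → k < N → u i ≠ 0 → u k ≠ 0 → c k < c i)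
    (hne : ∃ k < N, u k ≠ 0) :
    0 < ∑ k ∈ Finset.range N, c k * u k := by
  obtain ⟨d, rfl⟩ := Nat.exists_eq_add_of_le hj
  rw [Finset.sum_range_add]
  have hcr : ∀ i k, i < k → k < d → u (j + i) ≠ 0 → u (j + k) ≠ 0 → c (j + k) < c (j + i) :=
    fun i k hik hk => hright _ _ (by omega) (by omega) (by omega)
  have hpr : ∀ k < d, u (j + k) ≠ 0 → 0 < c (j + k) := fun k hk => hpos _ (by omega) (by omega)
  have hSr : ∀ m ≤ d, 0 ≤ ∑ k ∈ Finset.range m, u (j + k) := fun m hm => by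
    have := hmin (j + m) (by omega)
    rw [Finset.sum_range_add] at this
    linarith
  have hcl : ∀ i k, i < k → k < j → -u (j - 1 - i) ≠ 0 → -u (j - 1 - k) ≠ 0 →
      -c (j - 1 - k) < -c (j - 1 - i) := fun i k hik hk hi hk' =>
    neg_lt_neg (hleft _ _ (by omega) (by omega) (neg_ne_zero.1 hk') (neg_ne_zero.1 hi))
  have hpl : ∀ k < j, -u (j - 1 - k) ≠ 0 → 0 < -c (j - 1 - k) := fun k hk h =>
    neg_pos.2 (hneg _ (by omega) (neg_ne_zero.1 h))
  have hrefl : ∀ m ≤ j, ∑ k ∈ Finset.range m, -u (j - 1 - k) =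
      ∑ k ∈ Finset.range (j - m), u k - ∑ k ∈ Finset.range j, u k := by
    intro m
    induction m with
    | zero => simp
    | succ m ih =>
      intro hm
      have h1 : j - m = (j - (m + 1)) + 1 := by omega
      have h2 : j - 1 - m = j - (m + 1) := by omega
      rw [Finset.sum_range_succ, ih (by omega), h1, Finset.sum_range_succ, h2]
      ring
  have hSl : ∀ m ≤ j, 0 ≤ ∑ k ∈ Finset.range m, -u (j - 1 - k) := fun m hm => by
    rw [hrefl m hm]
    exact sub_nonneg.2 (hmin _ (by omega))
  have hsum : ∑ k ∈ Finset.range j, -c (j - 1 - k) * -u (j - 1 - k) =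
      ∑ k ∈ Finset.range j, c k * u k := by
    simp_rw [neg_mul_neg]
    exact Finset.sum_range_reflect (fun k => c k * u k) j
  have hl := sum_mul_nonneg_of_partial_sums_nonneg hcl hpl hSl
  have hr := sum_mul_nonneg_of_partial_sums_nonneg hcr hpr hSr
  rw [hsum] at hl
  obtain ⟨k, hk, huk⟩ := hne
  rcases lt_or_ge k j with hkj | hkj
  · have := sum_mul_pos_of_partial_sums_nonneg hcl hpl hSl
      ⟨j - 1 - k, by omega, by rwa [show j - 1 - (j - 1 - k) = k by omega, neg_ne_zero]⟩
    rw [hsum] at this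
    linarith
  · have := sum_mul_pos_of_partial_sums_nonneg hcr hpr hSr
      ⟨k - j, by omega, by rwa [Nat.add_sub_cancel' hkj]⟩
    linarith

/-- Chords of a strictly concave function have smaller slope when both ends move right. -/
theorem StrictConcaveOn.slope_lt_slope_of_shift {s : Set ℝ} {f : ℝ → ℝ}
    (hf : StrictConcaveOn ℝ s f) {p q p' q' : ℝ} (hp : p ∈ s) (hq : q ∈ s) (hp' : p' ∈ s)
    (hq' : q' ∈ s) (hpq : p ≠ q) (hpq' : p' ≠ q') (hpp : p < p') (hqq : q < q') :
    (f p' - f q') / (p' - q') < (f p - f q) / (p - q) := by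
  have comm : ∀ a b : ℝ, (f a - f b) / (a - b) = (f b - f a) / (b - a) := fun a b => by
    rw [← neg_sub (f b), ← neg_sub b, neg_div_neg_eq]
  by_cases h : q = p'
  · subst h
    rw [comm q q']
    exact hf.secant_strict_mono hq hp hq' hpq hqq.ne' (hpp.trans hqq)
  · calc (f p' - f q') / (p' - q') = (f q' - f p') / (q' - p') := comm _ _
      _ < (f q - f p') / (q - p') := hf.secant_strict_mono hp' hq hq' h hpq'.symm hqq
      _ = (f p' - f q) / (p' - q) := comm _ _
      _ < (f p - f q) / (p - q) := hf.secant_strict_mono hq hp hp' hpq (Ne.symm h) hpp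

theorem mem_nodeInterval_iff {n : ℕ} {y : Fin n → ℝ} (hy : y ∈ openSimplex n) (j : Fin (n + 1))
    (t : ℝ) : t ∈ nodeInterval y j ↔ t ∈ Icc (0 : ℝ) 1 ∧
      (∀ k : Fin n, (k : ℕ) < j → y k ≤ t) ∧ ∀ k : Fin n, (j : ℕ) ≤ k → t ≤ y k := by
  obtain ⟨hmono, hmem⟩ := hy
  have hjn : (j : ℕ) ≤ n := Nat.lt_succ_iff.1 j.2
  have hlow : extNode y j.castSucc ≤ t ↔ 0 ≤ t ∧ ∀ k : Fin n, (k : ℕ) < j → y k ≤ t := by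
    unfold extNode
    simp only [Fin.val_castSucc]
    split_ifs with h0
    · simp [h0]
    · refine ⟨fun h => ⟨(hmem _).1.le.trans h, fun k hk => (hmono.monotone ?_).trans h⟩,
        fun h => h.2 _ ?_⟩
      · exact Fin.le_def.2 (by simp; omega)
      · exact show (j : ℕ) - 1 < j by omega
  have hup : t ≤ extNode y j.succ ↔ t ≤ 1 ∧ ∀ k : Fin n, (j : ℕ) ≤ k → t ≤ y k := by
    unfold extNode
    simp only [Fin.val_succ]
    rw [dif_neg (Nat.succ_ne_zero _)]
    split_ifs with h1
    · refine ⟨fun h => ⟨h.trans (hmem _).2.le, fun k hk => h.trans (hmono.monotone ?_)⟩,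
        fun h => h.2 _ ?_⟩
      · exact Fin.le_def.2 (by simpa using hk)
      · simp
    · exact ⟨fun h => ⟨h, fun k hk => absurd k.2 (by omega)⟩, fun h => h.1⟩
  unfold nodeInterval
  rw [mem_Icc, hlow, hup, mem_Icc]
  tauto

theorem nodeInterval_nonempty {n : ℕ} {y : Fin n → ℝ} (hy : y ∈ openSimplex n)
    (j : Fin (n + 1)) : (nodeInterval y j).Nonempty := by
  by_cases h0 : (j : ℕ) = 0
  · refine ⟨0, (mem_nodeInterval_iff hy j 0).2 ⟨by simp, ?_, fun k _ => (hy.2 k).1.le⟩⟩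
    intro k hk
    omega
  · have hjn : (j : ℕ) ≤ n := Nat.lt_succ_iff.1 j.2
    refine ⟨y ⟨j - 1, by omega⟩, (mem_nodeInterval_iff hy j _).2
      ⟨Ioo_subset_Icc_self (hy.2 _), fun k hk => hy.1.monotone ?_, fun k hk => hy.1.monotone ?_⟩⟩
    · exact Fin.le_def.2 (by simp; omega)
    · exact Fin.le_def.2 (by simp; omega)

theorem IsKernel.continuousAt {K : ℝ → EReal} (hK : IsKernel K) {t : ℝ}
    (ht : t ∈ Ioo (-1 : ℝ) 1) : ContinuousAt K t := by
  have lift : ∀ s : Set ℝ, IsOpen s → s ⊆ Ioo (-1 : ℝ) 1 → 0 ∉ s →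
      ConcaveOn ℝ s (fun t => (K t).toReal) → t ∈ s → ContinuousAt K t := by
    intro s hs hsub h0 hc hts
    have hreal := (hc.continuousOn hs).continuousAt (hs.mem_nhds hts)
    refine (continuous_coe_real_ereal.continuousAt.comp hreal).congr ?_
    filter_upwards [hs.mem_nhds hts] with v hv
    exact EReal.coe_toReal (hK.ne_top v)
      (hK.finite_off_zero v (hsub hv) (by rintro rfl; exact h0 hv))
  rcases lt_trichotomy t 0 with h | rfl | h
  · exact lift _ isOpen_Ioo (Ioo_subset_Ioo_right zero_le_one) (by simp) hK.concave_neg ⟨ht.1, h⟩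
  · exact continuousAt_iff_continuous_left'_right'.2 ⟨hK.lim_zero_left, hK.lim_zero_right⟩
  · exact lift _ isOpen_Ioo (Ioo_subset_Ioo_left (by norm_num)) (by simp) hK.concave_pos ⟨h, ht.2⟩

theorem EReal.continuousAt_finset_sum {ι X : Type*} [TopologicalSpace X] {f : ι → X → EReal}
    {a : X} (s : Finset ι) (hf : ∀ i ∈ s, ContinuousAt (f i) a) (htop : ∀ i ∈ s, f i a ≠ ⊤) :
    ContinuousAt (fun v => ∑ i ∈ s, f i v) a ∧ ∑ i ∈ s, f i a ≠ ⊤ := by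
  classical
  induction s using Finset.induction_on with
  | empty => simpa using continuousAt_const
  | insert i s hi ih =>
    obtain ⟨hc, ht⟩ := ih (fun k hk => hf k (Finset.mem_insert_of_mem hk))
      fun k hk => htop k (Finset.mem_insert_of_mem hk)
    have hi' := htop i (Finset.mem_insert_self i s)
    simp_rw [Finset.sum_insert hi]
    refine ⟨?_, EReal.add_ne_top hi' ht⟩
    exact ContinuousAt.comp (f := fun v => (f i v, ∑ k ∈ s, f k v))
      (EReal.continuousAt_add (Or.inl hi') (Or.inr ht))
      ((hf i (Finset.mem_insert_self i s)).prodMk hc)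

theorem EReal.coe_mul_ne_top {a : ℝ} (ha : 0 < a) {b : EReal} (hb : b ≠ ⊤) :
    (a : EReal) * b ≠ ⊤ := by
  induction b with
  | bot => simp [EReal.coe_mul_bot_of_pos ha]
  | coe b => exact_mod_cast EReal.coe_ne_top (a * b)
  | top => exact absurd rfl hb

theorem upperSemicontinuousOn_sumTrans {n : ℕ} {r : Fin n → ℝ} (hr : ∀ j, 0 < r j)
    {K J : ℝ → EReal} (hK : IsKernel K) (hJtop : ∀ t, J t ≠ ⊤)
    (hJ : UpperSemicontinuousOn J (Icc (0 : ℝ) 1)) {y : Fin n → ℝ} (hy : y ∈ openSimplex n) :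
    UpperSemicontinuousOn (sumTrans r K J y) (Icc (0 : ℝ) 1) := by
  intro t ht
  have hterm : ∀ k ∈ (Finset.univ : Finset (Fin n)),
      ContinuousAt (fun v => (r k : EReal) * K (v - y k)) t := by
    intro k _
    have hmem : t - y k ∈ Ioo (-1 : ℝ) 1 := by
      have := hy.2 k
      constructor <;> linarith [this.1, this.2, ht.1, ht.2]
    have hKk : ContinuousAt (fun v => K (v - y k)) t :=
      ContinuousAt.comp (f := fun v => v - y k) (hK.continuousAt hmem) (by fun_prop)
    exact EReal.Tendsto.const_mul hKk (Or.inl (EReal.coe_ne_bot _)) (Or.inl (EReal.coe_ne_top _))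
  obtain ⟨hc, htop⟩ := EReal.continuousAt_finset_sum Finset.univ hterm
    fun k _ => EReal.coe_mul_ne_top (hr k) (hK.ne_top _)
  exact UpperSemicontinuousWithinAt.add' (hJ t ht) hc.continuousWithinAt.upperSemicontinuousWithinAt
    (EReal.continuousAt_add (Or.inl (hJtop t)) (Or.inr htop))

theorem exists_mj_eq_sumTrans {n : ℕ} {r : Fin n → ℝ} (hr : ∀ j, 0 < r j)
    {K J : ℝ → EReal} (hK : IsKernel K) (hJtop : ∀ t, J t ≠ ⊤)
    (hJ : UpperSemicontinuousOn J (Icc (0 : ℝ) 1)) {y : Fin n → ℝ} (hy : y ∈ openSimplex n)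
    (j : Fin (n + 1)) : ∃ t ∈ nodeInterval y j, mj r K J j y = sumTrans r K J y t := by
  have hsub : nodeInterval y j ⊆ Icc (0 : ℝ) 1 := fun t ht => ((mem_nodeInterval_iff hy j t).1 ht).1
  obtain ⟨t, ht, hmax⟩ := UpperSemicontinuousOn.exists_isMaxOn (nodeInterval_nonempty hy j)
    isCompact_Icc ((upperSemicontinuousOn_sumTrans hr hK hJtop hJ hy).mono hsub)
  refine ⟨t, ht, le_antisymm (sSup_le ?_) (le_sSup (mem_image_of_mem _ ht))⟩
  rintro _ ⟨v, hv, rfl⟩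
  exact hmax hv

theorem ne_node_of_sumTrans_ne_bot {n : ℕ} {r : Fin n → ℝ} (hr : ∀ j, 0 < r j)
    {K J : ℝ → EReal} (hsing : SingularKernel K) {y : Fin n → ℝ} {t : ℝ}
    (h : sumTrans r K J y t ≠ ⊥) (k : Fin n) : t ≠ y k := by
  rintro rfl
  apply h
  unfold sumTrans
  rw [← Finset.add_sum_erase _ _ (Finset.mem_univ k), sub_self, show K 0 = ⊥ from hsing,
    EReal.coe_mul_bot_of_pos (hr k), EReal.bot_add, EReal.add_bot]

theorem sumTrans_eq_coe {n : ℕ} (r : Fin n → ℝ) {K J : ℝ → EReal} (hK : IsKernel K)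
    {y : Fin n → ℝ} (hy : y ∈ openSimplex n) {t : ℝ} (ht : t ∈ Icc (0 : ℝ) 1)
    (hne : ∀ k, t ≠ y k) :
    sumTrans r K J y t = J t + ((∑ k, r k * (K (t - y k)).toReal : ℝ) : EReal) := by
  have hfin : ∀ k, ((K (t - y k)).toReal : EReal) = K (t - y k) := fun k => by
    refine EReal.coe_toReal (hK.ne_top _) (hK.finite_off_zero _ ?_ (sub_ne_zero.2 (hne k)))
    have := hy.2 k
    constructor <;> linarith [this.1, this.2, ht.1, ht.2]
  have hsum : ∀ (s : Finset (Fin n)) (f : Fin n → ℝ),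
      ((∑ k ∈ s, f k : ℝ) : EReal) = ∑ k ∈ s, (f k : EReal) := fun s f =>
    map_sum (⟨⟨Real.toEReal, rfl⟩, EReal.coe_add⟩ : ℝ →+ EReal) f s
  unfold sumTrans
  rw [hsum]
  simp_rw [EReal.coe_mul, hfin]

/-- Comparison of two distinct node systems at an index minimizing the partial sums of
`r k * (x k - y k)`. -/
theorem sum_kernel_lt_of_partial_sums_min {n : ℕ} {r : Fin n → ℝ} (hr : ∀ j, 0 < r j)
    {κ : ℝ → ℝ} (hcneg : StrictConcaveOn ℝ (Ioo (-1 : ℝ) 0) κ)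
    (hcpos : StrictConcaveOn ℝ (Ioo (0 : ℝ) 1) κ) (hanti : StrictAntiOn κ (Ioo (-1 : ℝ) 0))
    (hmono : StrictMonoOn κ (Ioo (0 : ℝ) 1)) {x y : Fin n → ℝ} (hx : StrictMono x)
    (hy : StrictMono y) (hxy : x ≠ y) {j : ℕ} (hj : j ≤ n) {u : ℕ → ℝ}
    (hu : ∀ k : Fin n, u k = r k * (x k - y k))
    (hmin : ∀ m ≤ n, ∑ k ∈ Finset.range j, u k ≤ ∑ k ∈ Finset.range m, u k) {t : ℝ}
    (hleft : ∀ k : Fin n, (k : ℕ) < j → t - x k ∈ Ioo (0 : ℝ) 1 ∧ t - y k ∈ Ioo (0 : ℝ) 1)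
    (hright : ∀ k : Fin n, j ≤ (k : ℕ) → t - x k ∈ Ioo (-1 : ℝ) 0 ∧ t - y k ∈ Ioo (-1 : ℝ) 0) :
    ∑ k, r k * κ (t - y k) < ∑ k, r k * κ (t - x k) := by
  let w : Fin n → ℝ := fun k => -((κ (t - x k) - κ (t - y k)) / ((t - x k) - (t - y k)))
  let c : ℕ → ℝ := fun k => if h : k < n then w ⟨k, h⟩ else 0
  have hcw : ∀ k : Fin n, c k = w k := fun k => dif_pos k.2
  have hune : ∀ k : Fin n, u k ≠ 0 → x k ≠ y k := fun k h he => h (by rw [hu, he]; ring)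
  have hshift : ∀ i k : Fin n, i < k → x i ≠ y i → x k ≠ y k → ∀ s : Set ℝ,
      StrictConcaveOn ℝ s κ → t - x i ∈ s ∧ t - y i ∈ s → t - x k ∈ s ∧ t - y k ∈ s →
      w k < w i := fun i k hik hi hk s hs hsi hsk =>
    neg_lt_neg (hs.slope_lt_slope_of_shift hsk.1 hsk.2 hsi.1 hsi.2
      (fun h => hk (sub_right_injective h)) (fun h => hi (sub_right_injective h))
      (sub_lt_sub_left (hx hik) t) (sub_lt_sub_left (hy hik) t))
  have hdiff : ∑ k : Fin n, c k * u k =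
      ∑ k, r k * κ (t - x k) - ∑ k, r k * κ (t - y k) := by
    rw [← Finset.sum_sub_distrib]
    refine Finset.sum_congr rfl fun k _ => ?_
    rw [hcw, hu]
    by_cases h : x k = y k
    · simp [h]
    · have : t - x k - (t - y k) ≠ 0 := fun h' => h (by linarith)
      simp only [w]
      field_simp
      ring
  rw [← sub_pos, ← hdiff, Fin.sum_univ_eq_sum_range (fun k => c k * u k) n]
  refine sum_mul_pos_of_partial_sums_min hj hmin ?_ ?_ ?_ ?_ ?_
  · intro k hk huk
    have hkn : k < n := by omega
    obtain ⟨h1, h2⟩ := hleft ⟨k, hkn⟩ hk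
    rw [hcw ⟨k, hkn⟩, neg_lt_zero]
    rcases lt_or_gt_of_ne (hune ⟨k, hkn⟩ huk) with h | h
    · exact div_pos (sub_pos.2 (hmono h2 h1 (by linarith))) (by linarith)
    · exact div_pos_of_neg_of_neg (sub_neg.2 (hmono h1 h2 (by linarith))) (by linarith)
  · intro k hk hkn huk
    obtain ⟨h1, h2⟩ := hright ⟨k, hkn⟩ hk
    rw [hcw ⟨k, hkn⟩, neg_pos]
    rcases lt_or_gt_of_ne (hune ⟨k, hkn⟩ huk) with h | h
    · exact div_neg_of_neg_of_pos (sub_neg.2 (hanti h2 h1 (by linarith))) (by linarith)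
    · exact div_neg_of_pos_of_neg (sub_pos.2 (hanti h1 h2 (by linarith))) (by linarith)
  · intro i k hik hk hi hk'
    have hkn : k < n := by omega
    have hin : i < n := by omega
    rw [hcw ⟨k, hkn⟩, hcw ⟨i, hin⟩]
    exact hshift ⟨i, hin⟩ ⟨k, hkn⟩ hik (hune ⟨i, hin⟩ hi) (hune ⟨k, hkn⟩ hk') _ hcpos
      (hleft ⟨i, hin⟩ (hik.trans hk)) (hleft ⟨k, hkn⟩ hk)
  · intro i k hji hik hkn hi hk'
    have hin : i < n := by omega
    rw [hcw ⟨k, hkn⟩, hcw ⟨i, hin⟩]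
    exact hshift ⟨i, hin⟩ ⟨k, hkn⟩ hik (hune ⟨i, hin⟩ hi) (hune ⟨k, hkn⟩ hk') _ hcneg
      (hright ⟨i, hin⟩ hji) (hright ⟨k, hkn⟩ (hji.trans hik.le))
  · obtain ⟨k, hk⟩ := Function.ne_iff.1 hxy
    exact ⟨k, k.2, by rw [hu]; exact mul_ne_zero (hr k).ne' (sub_ne_zero.2 hk)⟩

theorem exists_mj_lt_mj_of_ne {n : ℕ} {r : Fin n → ℝ} (hr : ∀ j, 0 < r j)
    {K J : ℝ → EReal} (hK : IsKernel K) (hsing : SingularKernel K)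
    (hsc : StrictConcaveKernel K) (hsm : StrictMonotoneKernel K) (hJtop : ∀ t, J t ≠ ⊤)
    (hJ : UpperSemicontinuousOn J (Icc (0 : ℝ) 1)) {x y : Fin n → ℝ} (hx : x ∈ openSimplex n)
    (hy : y ∈ regSet r K J) (hxy : x ≠ y) :
    ∃ j : Fin (n + 1), mj r K J j y < mj r K J j x := by
  obtain ⟨hy, hbot⟩ := hy
  let u : ℕ → ℝ := fun k => if h : k < n then r ⟨k, h⟩ * (x ⟨k, h⟩ - y ⟨k, h⟩) else 0
  have hu : ∀ k : Fin n, u k = r k * (x k - y k) := fun k => dif_pos k.2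
  obtain ⟨j, hj, hmin⟩ := Finset.exists_min_image (Finset.range (n + 1))
    (fun m => ∑ k ∈ Finset.range m, u k) ⟨0, by simp⟩
  have hjn : j ≤ n := Nat.lt_succ_iff.1 (Finset.mem_range.1 hj)
  replace hmin : ∀ m ≤ n, ∑ k ∈ Finset.range j, u k ≤ ∑ k ∈ Finset.range m, u k :=
    fun m hm => hmin m (Finset.mem_range.2 (by omega))
  obtain ⟨t, ht, hmt⟩ :=
    exists_mj_eq_sumTrans hr hK hJtop hJ hy ⟨j, Nat.lt_succ_iff.2 hjn⟩
  have hFbot : sumTrans r K J y t ≠ ⊥ := hmt ▸ hbot _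
  have hty := ne_node_of_sumTrans_ne_bot hr hsing hFbot
  obtain ⟨ht01, htl, htr⟩ := (mem_nodeInterval_iff hy _ t).1 ht
  have hyl : ∀ k : Fin n, (k : ℕ) < j → y k < t := fun k hk =>
    lt_of_le_of_ne (htl k hk) (hty k).symm
  have hyr : ∀ k : Fin n, j ≤ (k : ℕ) → t < y k := fun k hk => lt_of_le_of_ne (htr k hk) (hty k)
  have hxl : ∀ k : Fin n, (k : ℕ) < j → x k < t := by
    intro k hk
    have hlast : j - 1 < n := by omega
    have hs := hmin (j - 1) (by omega)
    rw [show j = j - 1 + 1 by omega, Finset.sum_range_succ, Nat.add_sub_cancel,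
      hu ⟨j - 1, hlast⟩] at hs
    have h1 : x ⟨j - 1, hlast⟩ - y ⟨j - 1, hlast⟩ ≤ 0 :=
      nonpos_of_mul_nonpos_right (by linarith) (hr ⟨j - 1, hlast⟩)
    have h2 : x k ≤ x ⟨j - 1, hlast⟩ := hx.1.monotone (Fin.le_def.2 (by simp; omega))
    have h3 := hyl ⟨j - 1, hlast⟩ (by simp; omega)
    linarith
  have hxr : ∀ k : Fin n, j ≤ (k : ℕ) → t < x k := by
    intro k hk
    have hfirst : j < n := by omega
    have hs := hmin (j + 1) (by omega)
    rw [Finset.sum_range_succ, hu ⟨j, hfirst⟩] at hs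
    have h1 : 0 ≤ x ⟨j, hfirst⟩ - y ⟨j, hfirst⟩ :=
      nonneg_of_mul_nonneg_right (by linarith) (hr ⟨j, hfirst⟩)
    have h2 : x ⟨j, hfirst⟩ ≤ x k := hx.1.monotone (Fin.le_def.2 hk)
    have h3 := hyr ⟨j, hfirst⟩ le_rfl
    linarith
  have htx : ∀ k, t ≠ x k := fun k => by
    rcases lt_or_ge (k : ℕ) j with h | h
    · exact (hxl k h).ne'
    · exact (hxr k h).ne
  have hfin : ∀ v ∈ Ioo (-1 : ℝ) 1, v ≠ 0 → ((K v).toReal : EReal) = K v := fun v hv h0 =>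
    EReal.coe_toReal (hK.ne_top v) (hK.finite_off_zero v hv h0)
  have hanti : StrictAntiOn (fun v => (K v).toReal) (Ioo (-1 : ℝ) 0) := fun a ha b hb hab =>
    EReal.coe_lt_coe_iff.1 (by
      rw [hfin a ⟨ha.1, by linarith [ha.2]⟩ ha.2.ne, hfin b ⟨hb.1, by linarith [hb.2]⟩ hb.2.ne]
      exact hsm.1 (Ioo_subset_Ico_self ha) (Ioo_subset_Ico_self hb) hab)
  have hmono : StrictMonoOn (fun v => (K v).toReal) (Ioo (0 : ℝ) 1) := fun a ha b hb hab =>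
    EReal.coe_lt_coe_iff.1 (by
      rw [hfin a ⟨by linarith [ha.1], ha.2⟩ ha.1.ne', hfin b ⟨by linarith [hb.1], hb.2⟩ hb.1.ne']
      exact hsm.2 (Ioo_subset_Ioc_self ha) (Ioo_subset_Ioc_self hb) hab)
  have hlt : ∑ k, r k * (K (t - y k)).toReal < ∑ k, r k * (K (t - x k)).toReal := by
    refine sum_kernel_lt_of_partial_sums_min hr hsc.1 hsc.2 hanti hmono hx.1 hy.1 hxy hjn hu hmin
      (fun k hk => ?_) fun k hk => ?_
    · refine ⟨⟨sub_pos.2 (hxl k hk), ?_⟩, ⟨sub_pos.2 (hyl k hk), ?_⟩⟩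
      · linarith [(hx.2 k).1, ht01.2]
      · linarith [(hy.2 k).1, ht01.2]
    · refine ⟨⟨?_, sub_neg.2 (hxr k hk)⟩, ⟨?_, sub_neg.2 (hyr k hk)⟩⟩
      · linarith [(hx.2 k).2, ht01.1]
      · linarith [(hy.2 k).2, ht01.1]
  have hJbot : J t ≠ ⊥ := fun h => hFbot (by rw [sumTrans, h, EReal.bot_add])
  refine ⟨⟨j, Nat.lt_succ_iff.2 hjn⟩, ?_⟩
  rw [hmt]
  refine lt_of_lt_of_le ?_ (le_sSup (mem_image_of_mem (sumTrans r K J x)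
    ((mem_nodeInterval_iff hx _ t).2 ⟨ht01, fun k hk => (hxl k hk).le, fun k hk => (hxr k hk).le⟩)))
  rw [sumTrans_eq_coe r hK hy ht01 hty, sumTrans_eq_coe r hK hx ht01 htx,
    ← EReal.coe_toReal (hJtop t) hJbot]
  exact_mod_cast add_lt_add_right hlt _

theorem statement12 (n : ℕ) (hn : 0 < n) (r : Fin n → ℝ) (hr : ∀ j, 0 < r j)
    (K J : ℝ → EReal) (hK : IsKernel K)
    (hsing : SingularKernel K) (hsc : StrictConcaveKernel K) (hsm : StrictMonotoneKernel K)
    (hJ : IsFieldFn n J) (hJusc : UpperSemicontinuousOn J (Icc (0:ℝ) 1))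
    (x y : Fin n → ℝ) (hx : x ∈ regSet r K J) (hy : y ∈ regSet r K J) :
    ((∀ j, mj r K J j x ≤ mj r K J j y) → x = y) ∧
    (x ≠ y → ∃ i j : Fin (n + 1),
      mj r K J i x < mj r K J i y ∧ mj r K J j y < mj r K J j x) := by
  have key : x ≠ y → ∃ j : Fin (n + 1), mj r K J j y < mj r K J j x :=
    exists_mj_lt_mj_of_ne hr hK hsing hsc hsm hJ.1 hJusc hx.1 hy
  refine ⟨fun h => ?_, fun hne => ?_⟩
  · by_contra hne
    obtain ⟨j, hj⟩ := key hne
    exact (h j).not_gt hj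
  · obtain ⟨j, hj⟩ := key hne
    obtain ⟨i, hi⟩ := exists_mj_lt_mj_of_ne hr hK hsing hsc hsm hJ.1 hJusc hy.1 hx hne.symm
    exact ⟨i, j, hi, hj⟩
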